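/- For every positive integer n, if α_n is an optimal set of n-points for P, then U_n(α_n) = { ((2j−1)/(2n), 0) : 1 ≤ j ≤ n }, which is the optimal set of n-means for P; in particular U_n maps any optimal set of n-points onto an optimal set of n-means for P. -/

import Mathlib

open MeasureTheory

noncomputable section

/-- The Euclidean plane ℝ². -/
abbrev Plane : Type := EuclideanSpace ℝ (Fin 2)

/-- The point (x, y) in the Euclidean plane. -/
def pt (x y : ℝ) : Plane := (WithLp.equiv 2 (Fin 2 → ℝ)).symm ![x, y]

/-- P: the uniform probability measure on the segment J = [0,1] × {0}, i.e. the pushforward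
of Lebesgue measure restricted to [0,1] under x ↦ (x, 0). -/
def P : Measure Plane :=
  Measure.map (fun x : ℝ => pt x 0) (volume.restrict (Set.Icc (0 : ℝ) 1))

/-- The constraint S_j = {(x, x + 1/j) : -1/j ≤ x ≤ 1}. -/
def S (j : ℕ) : Set Plane :=
  {p | ∃ x : ℝ, -(1 / (j : ℝ)) ≤ x ∧ x ≤ 1 ∧ p = pt x (x + 1 / (j : ℝ))}

/-- min_{b ∈ β} ‖y - b‖², written as an infimum over the image set. -/
def minDist (β : Set Plane) (y : Plane) : ℝ :=
  sInf ((fun b => ‖y - b‖ ^ 2) '' β)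

/-- The distortion error ∫ min_{b ∈ β} ‖y - b‖² dP(y) of a set β. -/
def distortion (β : Set Plane) : ℝ := ∫ y, minDist β y ∂P

/-- The n-th constrained quantization error for P with respect to the family (S_j). -/
def Vn (n : ℕ) : ℝ :=
  sInf {v : ℝ | ∃ α : Finset Plane,
    ↑α ⊆ (⋃ j ∈ Finset.Icc 1 n, S j) ∧ 1 ≤ α.card ∧ α.card ≤ n ∧ v = distortion ↑α}

/-- α is an optimal set of n-points for P: α ⊆ ⋃_{j=1}^n S_j, 1 ≤ card α ≤ n, and α attains the
n-th constrained quantization error. -/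
def IsOptimalNPoints (n : ℕ) (α : Finset Plane) : Prop :=
  ↑α ⊆ (⋃ j ∈ Finset.Icc 1 n, S j) ∧ 1 ≤ α.card ∧ α.card ≤ n ∧ distortion ↑α = Vn n

/-- The map U_n, which on S_n sends (x, x + 1/n) to (2x + 1/n, 0). -/
def U (n : ℕ) (p : Plane) : Plane := pt (2 * p 0 + 1 / (n : ℝ)) 0

/-- β is an optimal set of n-means for P: 1 ≤ card β ≤ n and β minimizes the unconstrained
distortion error among all subsets of ℝ² of cardinality at most n. -/
def IsOptimalNMeans (n : ℕ) (β : Finset Plane) : Prop :=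
  1 ≤ β.card ∧ β.card ≤ n ∧
    ∀ γ : Finset Plane, 1 ≤ γ.card → γ.card ≤ n → distortion ↑β ≤ distortion ↑γ

/-- The truncated parabola `max (r² - y²) 0`, with support `[-r, r]`. -/
def bump (r y : ℝ) : ℝ := max 0 (r ^ 2 - y ^ 2)

lemma continuous_bump (r : ℝ) : Continuous (bump r) := by
  unfold bump; fun_prop

lemma bump_nonneg (r y : ℝ) : 0 ≤ bump r y := le_max_left _ _

lemma bump_of_le_neg {r y : ℝ} (hr : 0 < r) (h : y ≤ -r) : bump r y = 0 :=
  max_eq_left (by nlinarith)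

lemma bump_of_ge {r y : ℝ} (hr : 0 < r) (h : r ≤ y) : bump r y = 0 :=
  max_eq_left (by nlinarith)

lemma bump_pos {r y : ℝ} (h₁ : -r < y) (h₂ : y < r) : 0 < bump r y :=
  lt_max_of_lt_right (by nlinarith)

lemma bump_intervalIntegrable (r a b : ℝ) : IntervalIntegrable (bump r) volume a b :=
  (continuous_bump r).intervalIntegrable a b

lemma integral_bump_support {r : ℝ} (hr : 0 < r) : ∫ y in (-r)..r, bump r y = 4 / 3 * r ^ 3 := by
  have h : ∫ y in (-r)..r, bump r y = ∫ y in (-r)..r, (r ^ 2 - y ^ 2) := by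
    refine intervalIntegral.integral_congr fun y hy => ?_
    rw [Set.uIcc_of_le (by linarith)] at hy
    exact max_eq_right (by nlinarith [hy.1, hy.2])
  rw [h, intervalIntegral.integral_sub (by simp) (by simp)]
  simp only [intervalIntegral.integral_const, integral_pow, smul_eq_mul]
  ring

lemma integral_bump_add {r a c : ℝ} (hr : 0 < r) :
    ∃ M, r ≤ M ∧ -M < a ∧ c < M ∧
      (∫ y in (-M)..a, bump r y) + (∫ y in a..c, bump r y) + (∫ y in c..M, bump r y)
        = 4 / 3 * r ^ 3 := by
  have ha := abs_nonneg a
  have hc := abs_nonneg c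
  refine ⟨|a| + |c| + r, by linarith, by linarith [neg_abs_le a], by linarith [le_abs_self c], ?_⟩
  set M := |a| + |c| + r
  have hM : r ≤ M := by linarith
  have hl : ∫ y in (-M)..(-r), bump r y = 0 := by
    refine intervalIntegral.integral_zero_ae (Filter.Eventually.of_forall fun y hy => ?_)
    rw [Set.uIoc_of_le (by linarith)] at hy
    exact bump_of_le_neg hr hy.2
  have hu : ∫ y in r..M, bump r y = 0 := by
    refine intervalIntegral.integral_zero_ae (Filter.Eventually.of_forall fun y hy => ?_)
    rw [Set.uIoc_of_le (by linarith)] at hy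
    exact bump_of_ge hr hy.1.le
  have hi := bump_intervalIntegrable r
  rw [intervalIntegral.integral_add_adjacent_intervals (hi _ _) (hi _ _),
    intervalIntegral.integral_add_adjacent_intervals (hi _ _) (hi _ _),
    ← intervalIntegral.integral_add_adjacent_intervals (hi (-M) (-r)) (hi _ _),
    ← intervalIntegral.integral_add_adjacent_intervals (hi (-r) r) (hi _ _),
    hl, hu, integral_bump_support hr]
  ring

lemma integral_bump_le {r a c : ℝ} (hr : 0 < r) :
    ∫ y in a..c, bump r y ≤ 4 / 3 * r ^ 3 := by
  obtain ⟨M, -, ha, hc, h⟩ := integral_bump_add (a := a) (c := c) hr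
  have h₁ := intervalIntegral.integral_nonneg (μ := volume) ha.le fun y _ => bump_nonneg r y
  have h₂ := intervalIntegral.integral_nonneg (μ := volume) hc.le fun y _ => bump_nonneg r y
  linarith

lemma integral_bump_lt {r a c : ℝ} (hr : 0 < r) (har : -r < a) :
    ∫ y in a..c, bump r y < 4 / 3 * r ^ 3 := by
  obtain ⟨M, hM, ha, hc, h⟩ := integral_bump_add (a := a) (c := c) hr
  have h₁ : 0 < ∫ y in (-M)..a, bump r y := by
    refine intervalIntegral.integral_pos ha (continuous_bump r).continuousOn
      (fun y _ => bump_nonneg r y) ⟨min a 0, ⟨?_, min_le_left _ _⟩, ?_⟩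
    · exact le_min ha.le (by linarith)
    · exact bump_pos (lt_min har (by linarith)) ((min_le_right _ _).trans_lt hr)
  have h₂ := intervalIntegral.integral_nonneg (μ := volume) hc.le fun y _ => bump_nonneg r y
  linarith

/-- The lower envelope used to bound the distortion of the finite set `s` on `[0, 1]`. -/
def envelope (r : ℝ) (s : Finset ℝ) (x : ℝ) : ℝ := r ^ 2 - ∑ u ∈ s, bump r (x - u)

lemma continuous_envelope (r : ℝ) (s : Finset ℝ) : Continuous (envelope r s) :=
  continuous_const.sub (continuous_finsetSum _ fun _ _ =>
    (continuous_bump r).comp (continuous_id.sub continuous_const))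

lemma envelope_le_sq {r x u : ℝ} {s : Finset ℝ} (hu : u ∈ s) : envelope r s x ≤ (x - u) ^ 2 := by
  have h₁ : bump r (x - u) ≤ ∑ v ∈ s, bump r (x - v) :=
    Finset.single_le_sum (f := fun v => bump r (x - v)) (fun v _ => bump_nonneg r _) hu
  have h₂ : r ^ 2 - (x - u) ^ 2 ≤ bump r (x - u) := le_max_right _ _
  unfold envelope
  linarith

lemma integral_envelope (r : ℝ) (s : Finset ℝ) :
    ∫ x in (0 : ℝ)..1, envelope r s x
      = r ^ 2 - ∑ u ∈ s, ∫ y in (-u)..(1 - u), bump r y := by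
  have hc (u : ℝ) : Continuous fun x : ℝ => bump r (x - u) :=
    (continuous_bump r).comp (continuous_id.sub continuous_const)
  unfold envelope
  rw [intervalIntegral.integral_sub (by simp)
      ((continuous_finsetSum _ fun u _ => hc u).intervalIntegrable _ _),
    intervalIntegral.integral_finsetSum fun u _ => (hc u).intervalIntegrable _ _]
  simp

lemma le_integral_envelope {n : ℕ} {r : ℝ} (hr : 0 < r) (hnr : 2 * n * r = 1) {s : Finset ℝ}
    (hs : s.card ≤ n) : r ^ 2 / 3 ≤ ∫ x in (0 : ℝ)..1, envelope r s x := by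
  rw [integral_envelope]
  have h₁ : ∑ u ∈ s, ∫ y in (-u)..(1 - u), bump r y ≤ s.card * (4 / 3 * r ^ 3) := by
    simpa using Finset.sum_le_card_nsmul s _ _ fun _ _ => integral_bump_le hr
  have h₂ : (s.card : ℝ) * (4 / 3 * r ^ 3) ≤ n * (4 / 3 * r ^ 3) := by gcongr
  have h₃ : n * (4 / 3 * r ^ 3) = 2 / 3 * r ^ 2 := by linear_combination 2 / 3 * r ^ 2 * hnr
  linarith

lemma lt_integral_envelope {n : ℕ} {r : ℝ} (hr : 0 < r) (hnr : 2 * n * r = 1) {s : Finset ℝ}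
    (hs : s.card ≤ n) {v : ℝ} (hv : v ∈ s) (hvr : v < r) :
    r ^ 2 / 3 < ∫ x in (0 : ℝ)..1, envelope r s x := by
  rw [integral_envelope]
  have h₁ : ∑ u ∈ s, ∫ y in (-u)..(1 - u), bump r y < ∑ _ ∈ s, 4 / 3 * r ^ 3 :=
    Finset.sum_lt_sum (fun _ _ => integral_bump_le hr)
      ⟨v, hv, integral_bump_lt hr (by linarith)⟩
  rw [Finset.sum_const, nsmul_eq_mul] at h₁
  have h₂ : (s.card : ℝ) * (4 / 3 * r ^ 3) ≤ n * (4 / 3 * r ^ 3) := by gcongr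
  have h₃ : n * (4 / 3 * r ^ 3) = 2 / 3 * r ^ 2 := by linear_combination 2 / 3 * r ^ 2 * hnr
  linarith

section LowerBound

variable {n : ℕ} {r : ℝ} {s : Finset ℝ} {f : ℝ → ℝ}

lemma envelope_le (h : ∀ x ∈ Set.Icc (0 : ℝ) 1, ∃ u ∈ s, (x - u) ^ 2 ≤ f x) {x : ℝ}
    (hx : x ∈ Set.Icc (0 : ℝ) 1) : envelope r s x ≤ f x := by
  obtain ⟨u, hu, hux⟩ := h x hx
  exact (envelope_le_sq hu).trans hux

lemma integral_envelope_le (hf : Continuous f)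
    (h : ∀ x ∈ Set.Icc (0 : ℝ) 1, ∃ u ∈ s, (x - u) ^ 2 ≤ f x) :
    ∫ x in (0 : ℝ)..1, envelope r s x ≤ ∫ x in (0 : ℝ)..1, f x :=
  intervalIntegral.integral_mono_on zero_le_one ((continuous_envelope r s).intervalIntegrable _ _)
    (hf.intervalIntegrable _ _) fun _ hx => envelope_le h hx

/-- Lower bound for the one-dimensional quantization error of the uniform distribution. -/
lemma sq_div_three_le_integral (hr : 0 < r) (hnr : 2 * n * r = 1) (hs : s.card ≤ n)
    (hf : Continuous f) (h : ∀ x ∈ Set.Icc (0 : ℝ) 1, ∃ u ∈ s, (x - u) ^ 2 ≤ f x) :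
    r ^ 2 / 3 ≤ ∫ x in (0 : ℝ)..1, f x :=
  (le_integral_envelope hr hnr hs).trans (integral_envelope_le hf h)

lemma eq_envelope_of_integral_le (hr : 0 < r) (hnr : 2 * n * r = 1) (hs : s.card ≤ n)
    (hf : Continuous f) (h : ∀ x ∈ Set.Icc (0 : ℝ) 1, ∃ u ∈ s, (x - u) ^ 2 ≤ f x)
    (hle : ∫ x in (0 : ℝ)..1, f x ≤ r ^ 2 / 3) {x : ℝ} (hx : x ∈ Set.Icc (0 : ℝ) 1) :
    f x = envelope r s x := by
  by_contra hne
  have hlt := lt_of_le_of_ne (envelope_le (r := r) h hx) (Ne.symm hne)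
  have hc := continuous_envelope r s
  have hpos : 0 < ∫ y in (0 : ℝ)..1, (f y - envelope r s y) :=
    intervalIntegral.integral_pos zero_lt_one (hf.sub hc).continuousOn
      (fun y hy => sub_nonneg.2 (envelope_le h (Set.Ioc_subset_Icc_self hy)))
      ⟨x, hx, sub_pos.2 hlt⟩
  rw [intervalIntegral.integral_sub (hf.intervalIntegrable _ _) (hc.intervalIntegrable _ _)] at hpos
  linarith [le_integral_envelope hr hnr hs]

lemma eq_of_bumps_overlap (h : ∀ x ∈ Set.Icc (0 : ℝ) 1, ∃ u ∈ s, (x - u) ^ 2 ≤ f x)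
    (heq : ∀ x ∈ Set.Icc (0 : ℝ) 1, f x = envelope r s x) {x u v : ℝ}
    (hx : x ∈ Set.Icc (0 : ℝ) 1) (hu : u ∈ s) (hv : v ∈ s)
    (hux : 0 < bump r (x - u)) (hvx : 0 < bump r (x - v)) : u = v := by
  obtain ⟨w, hw, hwx⟩ := h x hx
  rw [heq x hx, envelope] at hwx
  have key (z : ℝ) (hz : z ∈ s) (hzx : 0 < bump r (x - z)) : z = w := by
    by_contra hzw
    have hle : bump r (x - z) + bump r (x - w) ≤ ∑ y ∈ s, bump r (x - y) :=
      Finset.add_le_sum (f := fun y => bump r (x - y)) (fun y _ => bump_nonneg r _) hz hw hzw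
    have : r ^ 2 - (x - w) ^ 2 ≤ bump r (x - w) := le_max_right _ _
    linarith
  rw [key u hu hux, key v hv hvx]

lemma exists_abs_sub_le (hr : 0 < r) (h : ∀ x ∈ Set.Icc (0 : ℝ) 1, ∃ u ∈ s, (x - u) ^ 2 ≤ f x)
    (heq : ∀ x ∈ Set.Icc (0 : ℝ) 1, f x = envelope r s x) {x : ℝ}
    (hx : x ∈ Set.Icc (0 : ℝ) 1) : ∃ u ∈ s, |x - u| ≤ r := by
  obtain ⟨u, hu, hux⟩ := h x hx
  refine ⟨u, hu, abs_le_of_sq_le_sq (hux.trans ?_) hr.le⟩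
  rw [heq x hx, envelope]
  linarith [Finset.sum_nonneg fun u (_ : u ∈ s) => bump_nonneg r (x - u)]

lemma midpoint_mem (hr : 0 < r) (hnr : 2 * n * r = 1) (hs : s.card ≤ n)
    (hf : Continuous f) (h : ∀ x ∈ Set.Icc (0 : ℝ) 1, ∃ u ∈ s, (x - u) ^ 2 ≤ f x)
    (hle : ∫ x in (0 : ℝ)..1, f x ≤ r ^ 2 / 3) {k : ℕ} (hk : k < n) :
    (2 * k + 1) * r ∈ s := by
  have heq (x : ℝ) (hx : x ∈ Set.Icc (0 : ℝ) 1) : f x = envelope r s x :=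
    eq_envelope_of_integral_le hr hnr hs hf h hle hx
  induction k with
  | zero =>
    obtain ⟨u, hu, hur⟩ := exists_abs_sub_le hr h heq (x := 0) (by simp)
    have hru : r ≤ u := by
      by_contra! hlt
      exact absurd hle (not_le.2 ((lt_integral_envelope hr hnr hs hu hlt).trans_le
        (integral_envelope_le hf h)))
    have hur' : u = r := le_antisymm (by linarith [(abs_le.1 hur).1]) hru
    simpa [hur'] using hu
  | succ k ih =>
    have hm := ih (by omega)
    set m := (2 * (k : ℝ) + 1) * r with hmdef
    have hm0 : r ≤ m := by
      rw [hmdef]; nlinarith [mul_nonneg (Nat.cast_nonneg (α := ℝ) k) hr.le]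
    have hm1 : m + 3 * r ≤ 1 := by
      have : ((k + 1 + 1 : ℕ) : ℝ) ≤ n := by exact_mod_cast hk
      push_cast at this
      rw [hmdef]; nlinarith
    have hgoal : (2 * ((k + 1 : ℕ) : ℝ) + 1) * r = m + 2 * r := by
      rw [hmdef]; push_cast; ring
    rw [hgoal, ← Finset.mem_coe, ← s.finite_toSet.isClosed.closure_eq, Metric.mem_closure_iff]
    intro ε hε
    obtain ⟨δ, hδ0, hδ⟩ := exists_between (lt_min hε hr)
    have hδε := hδ.trans_le (min_le_left _ _)
    have hδr := hδ.trans_le (min_le_right _ _)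
    obtain ⟨u, hu, hur⟩ := exists_abs_sub_le hr h heq (x := m + r + δ)
      ⟨by linarith, by linarith⟩
    obtain ⟨h₁, h₂⟩ := abs_le.1 hur
    have hsep : m + 2 * r ≤ u := by
      by_contra! hlt
      have : m = u := eq_of_bumps_overlap h heq (x := (m + u) / 2)
        ⟨by linarith, by linarith⟩ hm hu (bump_pos (by linarith) (by linarith))
        (bump_pos (by linarith) (by linarith))
      linarith
    refine ⟨u, hu, ?_⟩
    rw [Real.dist_eq, abs_lt]
    constructor <;> linarith

/-- In the equality case of the lower bound, `f` vanishes at the midpoints. -/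
lemma nonpos_midpoint (hr : 0 < r) (hnr : 2 * n * r = 1) (hs : s.card ≤ n)
    (hf : Continuous f) (h : ∀ x ∈ Set.Icc (0 : ℝ) 1, ∃ u ∈ s, (x - u) ^ 2 ≤ f x)
    (hle : ∫ x in (0 : ℝ)..1, f x ≤ r ^ 2 / 3) {k : ℕ} (hk : k < n) :
    f ((2 * k + 1) * r) ≤ 0 := by
  have hkn : ((k + 1 : ℕ) : ℝ) ≤ n := by exact_mod_cast hk
  push_cast at hkn
  rw [eq_envelope_of_integral_le hr hnr hs hf h hle ⟨by positivity, by nlinarith⟩]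
  simpa using envelope_le_sq (r := r) (x := (2 * k + 1) * r)
    (midpoint_mem hr hnr hs hf h hle hk)

end LowerBound

/-- Upper bound for the one-dimensional quantization error of the uniform distribution. -/
lemma integral_le_sq_div_three {n : ℕ} {r : ℝ} (hr : 0 < r) (hnr : 2 * n * r = 1) {f : ℝ → ℝ}
    (hf : Continuous f) (h : ∀ k < n, ∀ x, f x ≤ (x - (2 * k + 1) * r) ^ 2) :
    ∫ x in (0 : ℝ)..1, f x ≤ r ^ 2 / 3 := by
  have hsum := intervalIntegral.sum_integral_adjacent_intervals (f := f) (μ := volume)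
    (a := fun k : ℕ => 2 * k * r) (n := n) fun k _ => hf.intervalIntegrable _ _
  simp only [hnr, Nat.cast_zero, mul_zero, zero_mul] at hsum
  rw [← hsum]
  have hcell : ∀ k ∈ Finset.range n,
      ∫ x in (2 * (k : ℝ) * r)..(2 * ((k + 1 : ℕ) : ℝ) * r), f x ≤ 2 / 3 * r ^ 3 := by
    intro k hk
    have hle := intervalIntegral.integral_mono_on (μ := volume) (f := f)
      (g := fun x => (x - (2 * k + 1) * r) ^ 2) (a := 2 * (k : ℝ) * r)
      (b := 2 * ((k + 1 : ℕ) : ℝ) * r) (by push_cast; nlinarith) (hf.intervalIntegrable _ _)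
      ((by fun_prop : Continuous fun x : ℝ => (x - (2 * k + 1) * r) ^ 2).intervalIntegrable _ _)
      fun x _ => h k (Finset.mem_range.1 hk) x
    refine hle.trans_eq ?_
    rw [intervalIntegral.integral_comp_sub_right (fun x => x ^ 2), integral_pow]
    push_cast
    ring
  refine (Finset.sum_le_card_nsmul _ _ _ hcell).trans_eq ?_
  rw [Finset.card_range, nsmul_eq_mul]
  linear_combination 1 / 3 * r ^ 2 * hnr

@[simp] lemma pt_apply_zero (x y : ℝ) : pt x y 0 = x := rfl

@[simp] lemma pt_apply_one (x y : ℝ) : pt x y 1 = y := rfl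

lemma continuous_pt_zero : Continuous fun x : ℝ => pt x 0 := by
  refine (PiLp.continuous_toLp 2 _).comp (continuous_pi fun i => ?_)
  fin_cases i
  · exact continuous_id
  · exact continuous_const

lemma norm_pt_sub_sq (x : ℝ) (c : Plane) : ‖pt x 0 - c‖ ^ 2 = (x - c 0) ^ 2 + c 1 ^ 2 := by
  simp [EuclideanSpace.norm_sq_eq]

section MinDist

variable {α : Finset Plane}

lemma minDist_eq_inf' (hα : α.Nonempty) :
    minDist α = fun y => α.inf' hα fun b => ‖y - b‖ ^ 2 := by
  funext y
  rw [Finset.inf'_eq_csInf_image]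
  rfl

lemma continuous_minDist (hα : α.Nonempty) : Continuous (minDist α) := by
  rw [minDist_eq_inf' hα]
  exact Continuous.finset_inf'_apply hα fun b _ => by fun_prop

lemma exists_minDist_eq (hα : α.Nonempty) (y : Plane) : ∃ a ∈ α, minDist α y = ‖y - a‖ ^ 2 := by
  rw [minDist_eq_inf' hα]
  exact Finset.exists_mem_eq_inf' hα _

lemma minDist_le {a : Plane} (ha : a ∈ α) (y : Plane) : minDist α y ≤ ‖y - a‖ ^ 2 := by
  rw [minDist_eq_inf' ⟨a, ha⟩]
  exact Finset.inf'_le _ ha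

lemma distortion_eq (hα : α.Nonempty) :
    distortion α = ∫ x in (0 : ℝ)..1, minDist α (pt x 0) := by
  rw [distortion, P, integral_map continuous_pt_zero.measurable.aemeasurable
    (continuous_minDist hα).aestronglyMeasurable, intervalIntegral.integral_of_le zero_le_one,
    integral_Icc_eq_integral_Ioc]

lemma continuous_minDist_pt (hα : α.Nonempty) : Continuous fun x => minDist α (pt x 0) :=
  (continuous_minDist hα).comp continuous_pt_zero

end MinDist

lemma distortion_nonneg (β : Set Plane) : 0 ≤ distortion β :=
  integral_nonneg fun y => Real.sInf_nonneg (by rintro _ ⟨b, -, rfl⟩; positivity)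

lemma sq_div_three_le_distortion {n : ℕ} {r : ℝ} (hr : 0 < r) (hnr : 2 * n * r = 1)
    {γ : Finset Plane} (h₁ : 1 ≤ γ.card) (hn : γ.card ≤ n) : r ^ 2 / 3 ≤ distortion γ := by
  have hγ := Finset.card_pos.1 h₁
  rw [distortion_eq hγ]
  refine sq_div_three_le_integral (s := γ.image fun c => c 0) hr hnr
    (Finset.card_image_le.trans hn) (continuous_minDist_pt hγ) fun x _ => ?_
  obtain ⟨a, ha, hax⟩ := exists_minDist_eq hγ (pt x 0)
  refine ⟨a 0, Finset.mem_image_of_mem _ ha, ?_⟩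
  rw [hax, norm_pt_sub_sq]
  nlinarith

lemma distortion_le_sq_div_three {n : ℕ} {r : ℝ} (hr : 0 < r) (hnr : 2 * n * r = 1)
    {γ : Finset Plane} (hγ : γ.Nonempty) (h : ∀ k < n, pt ((2 * (k : ℝ) + 1) * r) 0 ∈ γ) :
    distortion γ ≤ r ^ 2 / 3 := by
  rw [distortion_eq hγ]
  refine integral_le_sq_div_three hr hnr (continuous_minDist_pt hγ) fun k hk x => ?_
  refine (minDist_le (h k hk) _).trans_eq ?_
  simp [norm_pt_sub_sq]

/-- The excess of twice the squared distance over its least value on the constraint lines, as a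
function of a point on the segment. -/
def excess (n : ℕ) (α : Finset Plane) (x : ℝ) : ℝ :=
  2 * minDist α (pt x 0) - (x + 1 / (n : ℝ)) ^ 2

lemma continuous_excess (n : ℕ) {α : Finset Plane} (hα : α.Nonempty) :
    Continuous (excess n α) := by
  have := continuous_minDist_pt hα
  unfold excess
  fun_prop

lemma integral_excess (n : ℕ) {α : Finset Plane} (hα : α.Nonempty) :
    ∫ x in (0 : ℝ)..1, excess n α x
      = 2 * distortion α - ∫ x in (0 : ℝ)..1, (x + 1 / (n : ℝ)) ^ 2 := by
  unfold excess
  rw [intervalIntegral.integral_sub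
      (((continuous_minDist_pt hα).intervalIntegrable _ _).const_mul 2)
      ((by fun_prop : Continuous fun x : ℝ => (x + 1 / (n : ℝ)) ^ 2).intervalIntegrable _ _),
    intervalIntegral.integral_const_mul, distortion_eq hα]

/-- A point `a` of the line through `S j` has squared distance to `(x, 0)` equal to the mean of
`(x - u)²` and `(x + 1/j)²`, where `u = 2 a 0 + 1/j`. -/
lemma two_mul_norm_pt_sub_sq (x y c : ℝ) :
    2 * ‖pt x 0 - pt y (y + c)‖ ^ 2 = (x - (2 * y + c)) ^ 2 + (x + c) ^ 2 := by
  rw [norm_pt_sub_sq, pt_apply_zero, pt_apply_one]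
  ring

/-- The sum of the coordinates of a point; on `S j` this is `2 x + 1/j`. -/
def coordSum (p : Plane) : ℝ := p 0 + p 1

lemma exists_excess_eq {n : ℕ} {α : Finset Plane} (hα : α.Nonempty)
    (hsub : (α : Set Plane) ⊆ ⋃ j ∈ Finset.Icc 1 n, S j) (x : ℝ) :
    ∃ a ∈ α, ∃ j ∈ Finset.Icc 1 n, coordSum a = 2 * a 0 + 1 / (j : ℝ) ∧
      excess n α x = (x - coordSum a) ^ 2 + ((x + 1 / (j : ℝ)) ^ 2 - (x + 1 / (n : ℝ)) ^ 2) := by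
  obtain ⟨a, ha, hax⟩ := exists_minDist_eq hα (pt x 0)
  obtain ⟨j, hj, y, -, -, rfl⟩ : ∃ j ∈ Finset.Icc 1 n, a ∈ S j := by
    simpa only [Set.mem_iUnion, exists_prop] using hsub ha
  have hsum : coordSum (pt y (y + 1 / (j : ℝ))) = 2 * y + 1 / (j : ℝ) := by
    simp only [coordSum, pt_apply_zero, pt_apply_one]; ring
  refine ⟨_, ha, j, hj, hsum, ?_⟩
  rw [excess, hax, two_mul_norm_pt_sub_sq, hsum]
  ring

lemma one_div_le_of_mem_Icc {n j : ℕ} (hj : j ∈ Finset.Icc 1 n) : 1 / (n : ℝ) ≤ 1 / (j : ℝ) := by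
  rw [Finset.mem_Icc] at hj
  exact one_div_le_one_div_of_le (by exact_mod_cast hj.1) (by exact_mod_cast hj.2)

lemma exists_sq_le_excess {n : ℕ} {α : Finset Plane} (hα : α.Nonempty)
    (hsub : (α : Set Plane) ⊆ ⋃ j ∈ Finset.Icc 1 n, S j) {x : ℝ} (hx : 0 ≤ x) :
    ∃ u ∈ α.image coordSum, (x - u) ^ 2 ≤ excess n α x := by
  obtain ⟨a, ha, j, hj, -, hax⟩ := exists_excess_eq hα hsub x
  refine ⟨_, Finset.mem_image_of_mem _ ha, ?_⟩
  have : (x + 1 / (n : ℝ)) ^ 2 ≤ (x + 1 / (j : ℝ)) ^ 2 := by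
    gcongr (x + ?_) ^ 2
    exact one_div_le_of_mem_Icc hj
  linarith

lemma exists_U_eq_of_excess_nonpos {n : ℕ} {α : Finset Plane} (hα : α.Nonempty)
    (hsub : (α : Set Plane) ⊆ ⋃ j ∈ Finset.Icc 1 n, S j) {x : ℝ} (hx : 0 < x)
    (h : excess n α x ≤ 0) : ∃ a ∈ α, U n a = pt x 0 := by
  obtain ⟨a, ha, j, hj, hsum, hax⟩ := exists_excess_eq hα hsub x
  have hjn := one_div_le_of_mem_Icc hj
  have hn : 0 ≤ 1 / (n : ℝ) := by positivity
  have hxa := sq_nonneg (x - coordSum a)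
  have hjn' : 1 / (j : ℝ) = 1 / (n : ℝ) := by
    refine le_antisymm ?_ hjn
    by_contra! hlt
    nlinarith
  rw [hjn'] at hax hsum
  have hxa' : x - coordSum a = 0 := pow_eq_zero_iff two_ne_zero |>.1 (by linarith)
  exact ⟨a, ha, by rw [U, ← hsum, ← sub_eq_zero.1 hxa']⟩

/-- The point of `S n` which `U n` maps to `(u, 0)`. -/
def lift (n : ℕ) (u : ℝ) : Plane :=
  pt ((u - 1 / (n : ℝ)) / 2) ((u - 1 / (n : ℝ)) / 2 + 1 / (n : ℝ))

lemma integral_excess_le_of_isOptimal {n : ℕ} {r : ℝ} (hn : 1 ≤ n) (hr : 0 < r)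
    (hnr : 2 * n * r = 1) {α : Finset Plane} (h : IsOptimalNPoints n α) :
    ∫ x in (0 : ℝ)..1, excess n α x ≤ r ^ 2 / 3 := by
  classical
  obtain ⟨-, hα, -, hopt⟩ := h
  set β : Finset Plane := (Finset.range n).image fun k : ℕ => lift n ((2 * k + 1) * r)
  have hβ : β.Nonempty := ⟨_, Finset.mem_image_of_mem _ (Finset.mem_range.2 hn)⟩
  have hsub : (β : Set Plane) ⊆ ⋃ j ∈ Finset.Icc 1 n, S j := by
    intro p hp
    obtain ⟨k, hk, rfl⟩ := Finset.mem_image.1 (Finset.mem_coe.1 hp)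
    have hkn : ((k + 1 : ℕ) : ℝ) ≤ n := by exact_mod_cast Finset.mem_range.1 hk
    push_cast at hkn
    have hu0 : 0 ≤ (2 * (k : ℝ) + 1) * r := by positivity
    have hu1 : (2 * (k : ℝ) + 1) * r ≤ 1 := by nlinarith
    have hn0 : 0 ≤ 1 / (n : ℝ) := by positivity
    exact Set.mem_biUnion (Finset.mem_coe.2 (Finset.mem_Icc.2 ⟨hn, le_rfl⟩))
      ⟨_, by linarith, by linarith, rfl⟩
  have hVn : Vn n ≤ distortion β :=
    csInf_le ⟨0, by rintro _ ⟨γ, -, -, -, rfl⟩; exact distortion_nonneg _⟩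
      ⟨β, hsub, hβ.card_pos, Finset.card_image_le.trans_eq (Finset.card_range n), rfl⟩
  have hle : ∫ x in (0 : ℝ)..1, excess n β x ≤ r ^ 2 / 3 := by
    refine integral_le_sq_div_three hr hnr (continuous_excess n hβ) fun k hk x => ?_
    have hmem : lift n ((2 * k + 1) * r) ∈ β :=
      Finset.mem_image_of_mem _ (Finset.mem_range.2 hk)
    have hd := minDist_le hmem (pt x 0)
    have := two_mul_norm_pt_sub_sq x (((2 * k + 1) * r - 1 / (n : ℝ)) / 2) (1 / (n : ℝ))
    rw [show 2 * (((2 * k + 1) * r - 1 / (n : ℝ)) / 2) + 1 / (n : ℝ) = (2 * k + 1) * r by ring]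
      at this
    rw [lift] at hd
    rw [excess]
    linarith
  rw [integral_excess n hβ] at hle
  rw [integral_excess n (Finset.card_pos.1 hα)]
  linarith

lemma midpoint_mem_image_U {n : ℕ} {r : ℝ} (hn : 1 ≤ n) (hr : 0 < r) (hnr : 2 * n * r = 1)
    {α : Finset Plane} (h : IsOptimalNPoints n α) {k : ℕ} (hk : k < n) :
    ∃ a ∈ α, U n a = pt ((2 * k + 1) * r) 0 := by
  have hα := Finset.card_pos.1 h.2.1
  exact exists_U_eq_of_excess_nonpos hα h.1 (by positivity)
    (nonpos_midpoint hr hnr (Finset.card_image_le.trans h.2.2.1) (continuous_excess n hα)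
      (fun x hx => exists_sq_le_excess hα h.1 hx.1)
      (integral_excess_le_of_isOptimal hn hr hnr h) hk)

/-- if α_n is an optimal set of n-points for P, then
U_n(α_n) = {((2j−1)/(2n), 0) : 1 ≤ j ≤ n}, and U_n(α_n) is an optimal set of n-means for P. -/
theorem image_of_optimal_is_optimal_means (n : ℕ) (hn : 1 ≤ n) (α : Finset Plane)
    (h : IsOptimalNPoints n α) :
    letI : DecidableEq Plane := Classical.decEq _
    U n '' ↑α = ↑((Finset.Icc 1 n).image (fun j : ℕ => pt ((2 * (j : ℝ) - 1) / (2 * n)) 0)) ∧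
      IsOptimalNMeans n (α.image (U n)) := by
  let : DecidableEq Plane := Classical.decEq _
  have hn0 : (0 : ℝ) < n := by exact_mod_cast hn
  obtain ⟨r, hr⟩ : ∃ r : ℝ, r = 1 / (2 * n) := ⟨_, rfl⟩
  have hr0 : 0 < r := by rw [hr]; positivity
  have hnr : 2 * n * r = 1 := by rw [hr]; field_simp
  have hmid (k : ℕ) (hk : k < n) : pt ((2 * (k : ℝ) + 1) * r) 0 ∈ α.image (U n) :=
    Finset.mem_image.2 (midpoint_mem_image_U hn hr0 hnr h hk)
  set M := (Finset.Icc 1 n).image fun j : ℕ => pt ((2 * (j : ℝ) - 1) / (2 * n)) 0 with hM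
  have hcard : M.card = n := by
    rw [hM, Finset.card_image_of_injective, Nat.card_Icc, Nat.add_sub_cancel]
    intro i j hij
    have h0 : (2 * (i : ℝ) - 1) / (2 * n) = (2 * (j : ℝ) - 1) / (2 * n) :=
      congrArg (fun p : Plane => p 0) hij
    rw [div_left_inj' (by positivity)] at h0
    exact_mod_cast (by linarith : (i : ℝ) = j)
  have hsub : M ⊆ α.image (U n) := by
    intro p hp
    obtain ⟨j, hj, rfl⟩ := Finset.mem_image.1 hp
    obtain ⟨hj1, hjn⟩ := Finset.mem_Icc.1 hj
    obtain ⟨k, rfl⟩ : ∃ k, j = k + 1 := ⟨j - 1, by omega⟩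
    convert hmid k (by omega) using 2
    rw [hr]; push_cast; ring
  have hle : (α.image (U n)).card ≤ n := Finset.card_image_le.trans h.2.2.1
  have hne : (α.image (U n)).Nonempty := (Finset.card_pos.1 h.2.1).image _
  refine ⟨?_, hne.card_pos, hle, fun γ h₁ h₂ => ?_⟩
  · rw [Finset.eq_of_subset_of_card_le hsub (hle.trans_eq hcard.symm), Finset.coe_image]
  · exact (distortion_le_sq_div_three hr0 hnr hne hmid).trans
      (sq_div_three_le_distortion hr0 hnr h₁ h₂)

end
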